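/- Quadratic von Neumann rule: if Q is an admissible quantization of (P, P¹), then there exist real constants a and c with a² + c² ≠ 0 such that Q(S_i²) = a·Q(S_i)² + c·I for i = 1,2,3, and moreover Q(S_i S_ℓ) = (a/2)·(Q(S_i)Q(S_ℓ) + Q(S_ℓ)Q(S_i)) for all i ≠ ℓ. -/

import Mathlib

open MvPolynomial MeasureTheory

noncomputable section

attribute [local instance] Classical.propDecidable

/-- The Poisson bracket on `ℝ[X₀,X₁,X₂]` associated to the sphere:
`{f,g} = Σ εᵢⱼₖ Xᵢ ∂f/∂Xⱼ ∂g/∂Xₖ` (indices `0,1,2` play the role of `1,2,3`). -/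
def pb (f g : MvPolynomial (Fin 3) ℝ) : MvPolynomial (Fin 3) ℝ :=
  X 0 * (pderiv 1 f * pderiv 2 g - pderiv 2 f * pderiv 1 g) +
  X 1 * (pderiv 2 f * pderiv 0 g - pderiv 0 f * pderiv 2 g) +
  X 2 * (pderiv 0 f * pderiv 1 g - pderiv 1 f * pderiv 0 g)

/-- The ideal generated by `X₀² + X₁² + X₂² - s²`. -/
def sphereIdeal (s : ℝ) : Ideal (MvPolynomial (Fin 3) ℝ) :=
  Ideal.span {X 0 ^ 2 + X 1 ^ 2 + X 2 ^ 2 - C (s ^ 2)}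

/-- The Poisson algebra `P` of polynomial functions on the sphere of radius `s`. -/
abbrev SpherePoly (s : ℝ) := MvPolynomial (Fin 3) ℝ ⧸ sphereIdeal s

/-- The quotient map `ℝ[X₀,X₁,X₂] → P`. -/
def toSphere (s : ℝ) : MvPolynomial (Fin 3) ℝ →+* SpherePoly s :=
  Ideal.Quotient.mk (sphereIdeal s)

/-- The components `S₁, S₂, S₃` of the spin vector (indexed by `Fin 3`). -/
def S (s : ℝ) (i : Fin 3) : SpherePoly s := toSphere s (X i)

/-- A choice of polynomial representative of an element of `P`. -/
def rep (s : ℝ) (p : SpherePoly s) : MvPolynomial (Fin 3) ℝ :=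
  (Ideal.Quotient.mk_surjective (I := sphereIdeal s) p).choose

/-- The Poisson bracket descended to `P`.  (It is independent of the choice of
representatives, since the bracket of any polynomial with the generator
`X₀² + X₁² + X₂² - s²` vanishes identically.) -/
def pbS (s : ℝ) (p q : SpherePoly s) : SpherePoly s :=
  toSphere s (pb (rep s p) (rep s q))

/-- The pair `(Re (X₀ + i X₁) ^ k, Im (X₀ + i X₁) ^ k)` of sectoral harmonic polynomials. -/
def sectoral : ℕ → MvPolynomial (Fin 3) ℝ × MvPolynomial (Fin 3) ℝ
  | 0 => (1, 0)
  | k + 1 => (X 0 * (sectoral k).1 - X 1 * (sectoral k).2,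
      X 0 * (sectoral k).2 + X 1 * (sectoral k).1)

theorem sectoral_succ_fst (k : ℕ) :
    (sectoral (k + 1)).1 = X 0 * (sectoral k).1 - X 1 * (sectoral k).2 := rfl

theorem sectoral_succ_snd (k : ℕ) :
    (sectoral (k + 1)).2 = X 0 * (sectoral k).2 + X 1 * (sectoral k).1 := rfl

theorem pderiv_sectoral_succ (k : ℕ) :
    pderiv 0 (sectoral (k + 1)).1 = (k + 1) * (sectoral k).1 ∧
    pderiv 0 (sectoral (k + 1)).2 = (k + 1) * (sectoral k).2 ∧
    pderiv 1 (sectoral (k + 1)).1 = -((k + 1) * (sectoral k).2) ∧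
    pderiv 1 (sectoral (k + 1)).2 = (k + 1) * (sectoral k).1 := by
  induction k with
  | zero => simp [sectoral, pderiv_X]
  | succ k ih =>
    obtain ⟨h1, h2, h3, h4⟩ := ih
    rw [sectoral_succ_fst (k + 1), sectoral_succ_snd (k + 1)]
    simp only [map_add, map_sub, Derivation.leibniz, smul_eq_mul, h1, h2, h3, h4, pderiv_X,
      Pi.single_apply]
    rw [sectoral_succ_fst k, sectoral_succ_snd k]
    push_cast
    refine ⟨?_, ?_, ?_, ?_⟩ <;> simp <;> ring

theorem pderiv_two_sectoral (k : ℕ) :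
    pderiv 2 (sectoral k).1 = 0 ∧ pderiv 2 (sectoral k).2 = 0 := by
  induction k with
  | zero => simp [sectoral]
  | succ k ih => simp [sectoral, ih.1, ih.2, pderiv_X]

theorem pb_X_two_sectoral (k : ℕ) :
    pb (X 2) (sectoral k).1 = (k : ℝ) • (sectoral k).2 ∧
    pb (X 2) (sectoral k).2 = -((k : ℝ) • (sectoral k).1) := by
  cases k with
  | zero => simp [sectoral, pb]
  | succ k =>
    obtain ⟨h1, h2, h3, h4⟩ := pderiv_sectoral_succ k
    obtain ⟨h5, h6⟩ := pderiv_two_sectoral (k + 1)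
    simp only [pb, h1, h2, h3, h4, h5, h6, pderiv_X, smul_eq_C_mul]
    rw [sectoral_succ_fst, sectoral_succ_snd]
    constructor <;> simp <;> ring

/-- The Poisson bracket of representatives depends only on the classes modulo the sphere ideal. -/
theorem toSphere_pb_congr (s : ℝ) {f f' g g' : MvPolynomial (Fin 3) ℝ}
    (hf : toSphere s f = toSphere s f') (hg : toSphere s g = toSphere s g') :
    toSphere s (pb f g) = toSphere s (pb f' g') := by
  rw [toSphere, Ideal.Quotient.mk_eq_mk_iff_sub_mem, sphereIdeal,
    Ideal.mem_span_singleton] at hf hg ⊢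
  obtain ⟨a, ha⟩ := hf
  obtain ⟨b, hb⟩ := hg
  rw [sub_eq_iff_eq_add] at ha hb
  set R : MvPolynomial (Fin 3) ℝ := X 0 ^ 2 + X 1 ^ 2 + X 2 ^ 2 - C (s ^ 2) with hR
  have h0 : pderiv 0 R = 2 * X 0 := by simp [hR, pderiv_X, Derivation.leibniz_pow]
  have h1 : pderiv 1 R = 2 * X 1 := by simp [hR, pderiv_X, Derivation.leibniz_pow]
  have h2 : pderiv 2 R = 2 * X 2 := by simp [hR, pderiv_X, Derivation.leibniz_pow]
  refine ⟨pb a g' + pb f' b + R * pb a b, ?_⟩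
  subst ha hb
  simp only [pb, map_add, Derivation.leibniz, smul_eq_mul, h0, h1, h2]
  ring

theorem pbS_toSphere (s : ℝ) (f g : MvPolynomial (Fin 3) ℝ) :
    pbS s (toSphere s f) (toSphere s g) = toSphere s (pb f g) :=
  toSphere_pb_congr s
    (Ideal.Quotient.mk_surjective (I := sphereIdeal s) (toSphere s f)).choose_spec
    (Ideal.Quotient.mk_surjective (I := sphereIdeal s) (toSphere s g)).choose_spec

/-- A finite-dimensional representation of the polynomial Poisson algebra kills some sectoral
harmonic of positive degree. -/
theorem exists_map_sectoral_succ_eq_zero {A : Type*} [Ring A] [Algebra ℂ A]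
    [FiniteDimensional ℂ A]
    (q : MvPolynomial (Fin 3) ℝ →ₗ[ℝ] A)
    (hq : ∀ f g, q (pb f g) = -Complex.I • (q f * q g - q g * q f)) :
    ∃ k : ℕ, q (sectoral (k + 1)).1 = 0 ∧ q (sectoral (k + 1)).2 = 0 := by
  have hcomm (f : MvPolynomial (Fin 3) ℝ) :
      q (X 2) * q f - q f * q (X 2) = Complex.I • q (pb (X 2) f) := by
    rw [hq, smul_smul]; simp
  have h1 (k : ℕ) : q (X 2) * q (sectoral k).1 - q (sectoral k).1 * q (X 2) =
      (Complex.I * k) • q (sectoral k).2 := by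
    rw [hcomm, (pb_X_two_sectoral k).1, map_smul, ← Complex.coe_smul, smul_smul]; simp
  have h2 (k : ℕ) : q (X 2) * q (sectoral k).2 - q (sectoral k).2 * q (X 2) =
      -((Complex.I * k) • q (sectoral k).1) := by
    rw [hcomm, (pb_X_two_sectoral k).2, map_neg, map_smul, ← Complex.coe_smul, smul_neg, smul_smul]; simp
  have key : ∃ k : ℕ, q (sectoral (k + 1)).1 = 0 := by
    by_contra! hne
    let T : Module.End ℂ A := LinearMap.mulLeft ℂ (q (X 2)) - LinearMap.mulRight ℂ (q (X 2))
    have hT (k : ℕ) : (T ^ 2).HasEigenvector (((k + 1 : ℕ) : ℂ) ^ 2) (q (sectoral (k + 1)).1) := by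
      refine ⟨Module.End.mem_eigenspace_iff.2 ?_, hne k⟩
      have e1 : T (q (sectoral (k + 1)).1) =
          (Complex.I * (k + 1 : ℕ)) • q (sectoral (k + 1)).2 := by
        rw [← h1]; simp [T]
      have e2 : T (q (sectoral (k + 1)).2) =
          -((Complex.I * (k + 1 : ℕ)) • q (sectoral (k + 1)).1) := by
        rw [← h2]; simp [T]
      rw [sq, Module.End.mul_apply, e1, map_smul, e2, smul_neg, smul_smul, ← neg_smul]
      congr 1
      linear_combination (-((k + 1 : ℕ) : ℂ) ^ 2) * Complex.I_sq
    have hinj : Function.Injective fun k : ℕ => (((k + 1 : ℕ) : ℂ) ^ 2) := by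
      intro a b hab
      have : (a + 1) ^ 2 = (b + 1) ^ 2 := by
        have hab' : (((a + 1 : ℕ) : ℂ) ^ 2) = (((b + 1 : ℕ) : ℂ) ^ 2) := hab
        exact_mod_cast hab'
      have := Nat.pow_left_injective (n := 2) (by norm_num) this
      omega
    have hli := Module.End.eigenvectors_linearIndependent' (T ^ 2) _ hinj _ hT
    exact Module.Finite.not_linearIndependent_of_infinite _ hli
  obtain ⟨k, hk⟩ := key
  refine ⟨k, hk, ?_⟩
  have h := h1 (k + 1)
  rw [hk, mul_zero, zero_mul, sub_zero, eq_comm, smul_eq_zero] at h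
  refine h.resolve_left (mul_ne_zero Complex.I_ne_zero ?_)
  exact_mod_cast k.succ_ne_zero

/-- A subspace of polynomials closed under bracketing with arbitrary polynomials and containing
the sphere ideal contains the sectoral harmonics of degree
`k + 1` as soon as it contains those of degree `k + 2`. -/
theorem sectoral_succ_mem_of_succ_succ_mem {s : ℝ} (hs : s ≠ 0)
    (K : Submodule ℝ (MvPolynomial (Fin 3) ℝ))
    (hpb : ∀ f ∈ K, ∀ g, pb f g ∈ K) (hR : ∀ f, toSphere s f = 0 → f ∈ K) (k : ℕ)
    (h : (sectoral (k + 2)).1 ∈ K ∧ (sectoral (k + 2)).2 ∈ K) :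
    (sectoral (k + 1)).1 ∈ K ∧ (sectoral (k + 1)).2 ∈ K := by
  obtain ⟨hA, hB⟩ := h
  have hk : ((k : ℝ) + 1) ≠ 0 := by positivity
  have hk2 : ((k : ℝ) + 2) ≠ 0 := by positivity
  obtain ⟨d1, d2, d3, d4⟩ := pderiv_sectoral_succ k
  obtain ⟨d5, d6⟩ := pderiv_two_sectoral (k + 1)
  obtain ⟨e1, e2, e3, e4⟩ := pderiv_sectoral_succ (k + 1)
  obtain ⟨e5, e6⟩ := pderiv_two_sectoral (k + 2)
  have a1 := sectoral_succ_fst k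
  have b1 := sectoral_succ_snd k
  have a2 := sectoral_succ_fst (k + 1)
  have b2 := sectoral_succ_snd (k + 1)
  simp only [add_assoc, Nat.reduceAdd] at e1 e2 e3 e4 a2 b2
  set A0 := (sectoral k).1
  set B0 := (sectoral k).2
  set A1 := (sectoral (k + 1)).1
  set B1 := (sectoral (k + 1)).2
  set A2 := (sectoral (k + 2)).1
  set B2 := (sectoral (k + 2)).2
  have hC2 : (C 2 : MvPolynomial (Fin 3) ℝ) = 2 := map_ofNat C 2
  have of_smul {r : ℝ} (hr : r ≠ 0) {f : MvPolynomial (Fin 3) ℝ} (hf : C r * f ∈ K) : f ∈ K := by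
    rw [← smul_eq_C_mul] at hf
    exact (K.smul_mem_iff hr).1 hf
  have hA1 : X 2 * A1 ∈ K := by
    refine of_smul hk2 ?_
    convert K.neg_mem (hpb _ hB (X 0)) using 1
    simp [pb, e2, e4, e6, pderiv_X, hC2]; ring
  have hB1 : X 2 * B1 ∈ K := by
    refine of_smul hk2 ?_
    convert hpb _ hA (X 0) using 1
    simp [pb, e1, e3, e5, pderiv_X, hC2]; ring
  have hA1' : X 2 ^ 2 * A1 ∈ K := by
    refine of_smul (mul_ne_zero two_ne_zero hk) ?_
    convert hpb _ hB1 (X 2 ^ 2) using 1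
    simp [pb, d2, d4, d6, pderiv_X, hC2, Derivation.leibniz_pow]; rw [a1]; ring
  have hB1' : X 2 ^ 2 * B1 ∈ K := by
    refine of_smul (mul_ne_zero two_ne_zero hk) ?_
    convert K.neg_mem (hpb _ hA1 (X 2 ^ 2)) using 1
    simp [pb, d1, d3, d5, pderiv_X, hC2, Derivation.leibniz_pow]; rw [b1]; ring
  have hA2 : X 2 * A2 ∈ K := by
    refine of_smul (mul_ne_zero two_ne_zero hk2) ?_
    convert hpb _ hB (X 2 ^ 2) using 1
    simp [pb, e2, e4, e6, pderiv_X, hC2, Derivation.leibniz_pow]; rw [a2]; ring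
  have hB2 : X 2 * B2 ∈ K := by
    refine of_smul (mul_ne_zero two_ne_zero hk2) ?_
    convert K.neg_mem (hpb _ hA (X 2 ^ 2)) using 1
    simp [pb, e1, e3, e5, pderiv_X, hC2, Derivation.leibniz_pow]; rw [b2]; ring
  have hA2X0 : A2 * X 0 ∈ K := by
    convert K.sub_mem (K.smul_mem (k + 2 : ℝ) hA1') (hpb _ hA2 (X 1)) using 1
    simp [pb, e1, e3, e5, pderiv_X, hC2, smul_eq_C_mul]; ring
  have hA2X1 : A2 * X 1 ∈ K := by
    convert K.sub_mem (hpb _ hA2 (X 0)) (K.smul_mem (k + 2 : ℝ) hB1') using 1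
    simp [pb, e1, e3, e5, pderiv_X, hC2, smul_eq_C_mul]; ring
  have hB2X0 : B2 * X 0 ∈ K := by
    convert K.sub_mem (K.smul_mem (k + 2 : ℝ) hB1') (hpb _ hB2 (X 1)) using 1
    simp [pb, e2, e4, e6, pderiv_X, hC2, smul_eq_C_mul]; ring
  have hB2X1 : B2 * X 1 ∈ K := by
    convert K.add_mem (hpb _ hB2 (X 0)) (K.smul_mem (k + 2 : ℝ) hA1') using 1
    simp [pb, e2, e4, e6, pderiv_X, hC2, smul_eq_C_mul]; ring
  have hgen (f : MvPolynomial (Fin 3) ℝ) :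
      (X 0 ^ 2 + X 1 ^ 2 + X 2 ^ 2 - C (s ^ 2)) * f ∈ K :=
    hR _ <| Ideal.Quotient.eq_zero_iff_mem.2 <|
      Ideal.mul_mem_right _ _ (Ideal.mem_span_singleton_self _)
  constructor
  · refine of_smul (pow_ne_zero 2 hs) ?_
    convert K.sub_mem (K.add_mem (K.add_mem hA2X0 hB2X1) hA1') (hgen A1) using 1
    rw [a2, b2]; ring
  · refine of_smul (pow_ne_zero 2 hs) ?_
    convert K.sub_mem (K.add_mem (K.sub_mem hB2X0 hA2X1) hB1') (hgen B1) using 1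
    rw [a2, b2]; ring

/-- The generators `X i` lie in every subspace closed under the bracket, compatible with the
sphere relation, that contains the sectoral harmonics of some positive degree. -/
theorem X_mem_of_sectoral_succ_mem {s : ℝ} (hs : s ≠ 0)
    (K : Submodule ℝ (MvPolynomial (Fin 3) ℝ))
    (hpb : ∀ f ∈ K, ∀ g, pb f g ∈ K) (hR : ∀ f, toSphere s f = 0 → f ∈ K) (k : ℕ)
    (h : (sectoral (k + 1)).1 ∈ K ∧ (sectoral (k + 1)).2 ∈ K) (i : Fin 3) : X i ∈ K := by
  induction k with
  | succ k ih => exact ih (sectoral_succ_mem_of_succ_succ_mem hs K hpb hR k h)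
  | zero =>
    simp only [sectoral, zero_add, mul_one, mul_zero, sub_zero] at h
    fin_cases i
    · exact h.1
    · exact h.2
    · convert hpb _ h.1 (X 1) using 1
      simp [pb, pderiv_X]

/-- **Quadratic von Neumann rule** (Proposition 2.1): an admissible quantization of
`(P, P¹)` satisfies `Q(Sᵢ²) = a Q(Sᵢ)² + c I` with `a² + c² ≠ 0`, and
`Q(Sᵢ Sₗ) = (a/2)(Q(Sᵢ)Q(Sₗ) + Q(Sₗ)Q(Sᵢ))` for `i ≠ ℓ`. -/
theorem quadratic_vonNeumann_rule (s : ℝ) (hs : 0 < s)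
    (V : Type) [NormedAddCommGroup V] [InnerProductSpace ℂ V]
    [FiniteDimensional ℂ V] [Nontrivial V]
    (Q : SpherePoly s →ₗ[ℝ] Module.End ℂ V)
    (hselfadj : ∀ f : SpherePoly s, (Q f).IsSymmetric)
    (hbracket : ∀ f g : SpherePoly s,
      Q (pbS s f g) = -Complex.I • (Q f * Q g - Q g * Q f))
    (hone : Q 1 = 1)
    (hirred : ∀ W : Submodule ℂ V,
      (∀ i : Fin 3, ∀ v ∈ W, Q (S s i) v ∈ W) → W = ⊥ ∨ W = ⊤) :
    ∃ a c : ℝ, a ^ 2 + c ^ 2 ≠ 0 ∧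
      (∀ i : Fin 3, Q (S s i ^ 2) = (a : ℂ) • Q (S s i) ^ 2 + (c : ℂ) • 1) ∧
      (∀ i l : Fin 3, i ≠ l → Q (S s i * S s l) =
        ((a : ℂ) / 2) • (Q (S s i) * Q (S s l) + Q (S s l) * Q (S s i))) := by
  let q : MvPolynomial (Fin 3) ℝ →ₗ[ℝ] Module.End ℂ V :=
    Q ∘ₗ (Ideal.Quotient.mkₐ ℝ (sphereIdeal s)).toLinearMap
  have hq_apply (f : MvPolynomial (Fin 3) ℝ) : q f = Q (toSphere s f) := rfl
  have hq (f g : MvPolynomial (Fin 3) ℝ) :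
      q (pb f g) = -Complex.I • (q f * q g - q g * q f) := by
    rw [hq_apply, ← pbS_toSphere, hbracket]; rfl
  have hpb : ∀ f ∈ LinearMap.ker q, ∀ g, pb f g ∈ LinearMap.ker q := by
    intro f hf g
    rw [LinearMap.mem_ker] at hf ⊢
    rw [hq, hf]; simp
  have hR (f : MvPolynomial (Fin 3) ℝ) (hf : toSphere s f = 0) : f ∈ LinearMap.ker q := by
    rw [LinearMap.mem_ker, hq_apply, hf, map_zero]
  obtain ⟨k, hk⟩ := exists_map_sectoral_succ_eq_zero q hq
  have hX := X_mem_of_sectoral_succ_mem hs.ne' (LinearMap.ker q) hpb hR k hk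
  have hS (i : Fin 3) : Q (S s i) = 0 := hX i
  have h01 : q (X 0 * X 1) = 0 := by
    rw [← LinearMap.mem_ker]
    convert hpb _ (hX 1) (X 1 * X 2) using 1
    simp [pb, pderiv_X]
  have h12 : q (X 1 * X 2) = 0 := by
    rw [← LinearMap.mem_ker]
    convert hpb _ (hX 2) (X 2 * X 0) using 1
    simp [pb, pderiv_X, mul_comm]
  have h02 : q (X 0 * X 2) = 0 := by
    rw [← LinearMap.mem_ker]
    convert hpb _ (hX 0) (X 0 * X 1) using 1
    simp [pb, pderiv_X, mul_comm]
  have hd01 : q (X 0 ^ 2) = q (X 1 ^ 2) := by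
    rw [← sub_eq_zero, ← map_sub, ← LinearMap.mem_ker]
    convert (LinearMap.ker q).neg_mem (hpb _ (hX 2) (X 0 * X 1)) using 1
    simp [pb, pderiv_X]; ring
  have hd12 : q (X 1 ^ 2) = q (X 2 ^ 2) := by
    rw [← sub_eq_zero, ← map_sub, ← LinearMap.mem_ker]
    convert (LinearMap.ker q).neg_mem (hpb _ (hX 0) (X 1 * X 2)) using 1
    simp [pb, pderiv_X]; ring
  have hsum : q (X 0 ^ 2) + q (X 1 ^ 2) + q (X 2 ^ 2) = (s ^ 2) • 1 := by
    have h1 : q 1 = 1 := by rw [hq_apply, map_one, hone]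
    rw [← h1, ← map_smul, ← map_add, ← map_add, ← sub_eq_zero, ← map_sub, smul_eq_C_mul, mul_one]
    exact hR _ (Ideal.Quotient.eq_zero_iff_mem.2 (Ideal.mem_span_singleton_self _))
  have h2 : q (X 2 ^ 2) = (s ^ 2 / 3) • 1 := by
    rw [hd01, hd12] at hsum
    have : (3 : ℝ) • q (X 2 ^ 2) = (3 : ℝ) • ((s ^ 2 / 3) • (1 : Module.End ℂ V)) := by
      rw [smul_smul, mul_div_cancel₀ _ (by norm_num), ← hsum]; module
    exact smul_right_injective _ (by norm_num : (3 : ℝ) ≠ 0) this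
  have hsq (i : Fin 3) : Q (S s i ^ 2) = (s ^ 2 / 3) • 1 := by
    rw [S, ← map_pow, ← hq_apply]
    fin_cases i
    exacts [hd01.trans (hd12.trans h2), hd12.trans h2, h2]
  refine ⟨0, s ^ 2 / 3, by positivity, fun i => ?_, fun i l hil => ?_⟩
  · rw [hsq, hS, Complex.coe_smul (s ^ 2 / 3)]; simp
  · rw [hS, hS, S, S, ← map_mul, ← hq_apply]
    simp only [mul_zero, add_zero, smul_zero]
    fin_cases i <;> fin_cases l <;> first
      | exact absurd rfl hil
      | assumption
      | (rw [mul_comm]; assumption)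

end
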